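/- The Gauss hypergeometric series satisfies ₂F₁(1/8, 5/8; 3/4; 25920/25921) = (3/5) · 161^{1/4}. -/

import Mathlib

open scoped Nat

/-- Pochhammer symbol (rising factorial) on the reals. -/
noncomputable def poch (a : ℝ) (n : ℕ) : ℝ := ∏ i ∈ Finset.range n, (a + i)

/-- Gauss hypergeometric series ₂F₁(a,b;c;x) as a real series. -/
noncomputable def twoFone (a b c x : ℝ) : ℝ :=
  ∑' n : ℕ, poch a n * poch b n / (poch c n * (n ! : ℝ)) * x ^ n

open MeasureTheory Set

lemma poch_succ (a : ℝ) (n : ℕ) : poch a (n+1) = poch a n * (a + n) := by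
  simp [poch, Finset.prod_range_succ]
lemma poch_pos (a : ℝ) (ha : 0 < a) (n : ℕ) : 0 < poch a n := by
  apply Finset.prod_pos; intros; positivity

lemma poch_asc (a : ℝ) (n : ℕ) : poch a n = (ascPochhammer ℝ n).eval a := by
  induction n with
  | zero => simp [poch]
  | succ n ih => rw [poch_succ, ih, ascPochhammer_succ_eval]

lemma choose_poch (a : ℝ) (n : ℕ) : Ring.choose (a + n - 1) n = poch a n / n ! := by
  rw [poch_asc, Ring.choose, show a + n - 1 - n + 1 = a by ring]
  have := Ring.factorial_nsmul_multichoose_eq_ascPochhammer a n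
  rw [Polynomial.ascPochhammer_smeval_eq_eval, nsmul_eq_mul] at this
  rw [← this]
  field_simp

lemma binom_hasSum (u : ℝ) (hu : |u| < 1) :
    HasSum (fun n : ℕ => poch (1/4) n / n ! * u ^ n) ((1 - u) ^ (-(1/4) : ℝ)) := by
  have h := (Real.one_div_one_sub_rpow_hasFPowerSeriesOnBall_zero (1/4)).hasSum (y := u)
    (by simpa [enorm_eq_nnnorm, ← NNReal.coe_lt_coe] using hu)
  simp only [FormalMultilinearSeries.ofScalars_apply_eq, smul_eq_mul, choose_poch, zero_add] at h
  have h1 : 0 ≤ 1 - u := by linarith [(abs_lt.1 hu).2]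
  rw [Real.rpow_neg h1, ← one_div]
  exact h

lemma base_int : IntegrableOn (fun t : ℝ => (1 - t^2) ^ (-(3/4) : ℝ)) (Ioo (-1) 1) := by
  have h0 : IntervalIntegrable (fun t : ℝ => t ^ (-(3/4) : ℝ)) volume 0 2 :=
    intervalIntegral.intervalIntegrable_rpow' (by norm_num)
  have h1 : IntervalIntegrable (fun t : ℝ => (1 - t) ^ (-(3/4) : ℝ)) volume (-1) 1 := by
    have := (h0.comp_sub_left 1).symm
    norm_num at this ⊢
    exact this
  have h2 : IntervalIntegrable (fun t : ℝ => (1 + t) ^ (-(3/4) : ℝ)) volume (-1) 1 := by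
    have := (h0.comp_add_left 1)
    norm_num at this ⊢
    exact this
  have h3 := h1.add h2
  rw [intervalIntegrable_iff_integrableOn_Ioo_of_le (by norm_num)] at h3
  refine Integrable.mono' h3 ?_ ?_
  · apply Measurable.aestronglyMeasurable
    fun_prop
  · rw [ae_restrict_iff' measurableSet_Ioo]
    refine Filter.Eventually.of_forall fun t ht => ?_
    have a1 : 0 < 1 - t := by linarith [ht.2]
    have a2 : 0 < 1 + t := by linarith [ht.1]
    have : (1 - t^2 : ℝ) = (1-t)*(1+t) := by ring
    rw [this, Real.mul_rpow a1.le a2.le, Real.norm_eq_abs, abs_of_pos (by positivity)]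
    have p1 : 0 < (1-t) ^ (-(3/4) : ℝ) := by positivity
    have p2 : 0 < (1+t) ^ (-(3/4) : ℝ) := by positivity
    rcases le_total 0 t with h | h
    · have : (1+t) ^ (-(3/4) : ℝ) ≤ 1 := Real.rpow_le_one_of_one_le_of_nonpos (by linarith) (by norm_num)
      nlinarith
    · have : (1-t) ^ (-(3/4) : ℝ) ≤ 1 := Real.rpow_le_one_of_one_le_of_nonpos (by linarith) (by norm_num)
      nlinarith

noncomputable def bM (n : ℕ) : ℝ := ∫ t in Ioo (-1:ℝ) 1, t ^ n * (1 - t^2) ^ (-(3/4) : ℝ)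

lemma mom_int (n : ℕ) : IntegrableOn (fun t : ℝ => t^n * (1 - t^2) ^ (-(3/4) : ℝ)) (Ioo (-1) 1) := by
  refine Integrable.mono' base_int ?_ ?_
  · apply Measurable.aestronglyMeasurable
    fun_prop
  · rw [ae_restrict_iff' measurableSet_Ioo]
    refine Filter.Eventually.of_forall fun t ht => ?_
    have a1 : 0 < 1 - t^2 := by nlinarith [ht.2, ht.1]
    have p1 : 0 < (1-t^2) ^ (-(3/4) : ℝ) := by positivity
    rw [norm_mul, Real.norm_eq_abs, Real.norm_eq_abs, abs_of_pos p1, abs_pow]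
    have : |t|^n ≤ 1 := pow_le_one₀ (abs_nonneg t) (abs_le.2 ⟨ht.1.le, ht.2.le⟩)
    nlinarith

lemma bM_rec (n : ℕ) : bM (n+2) * (n + 3/2) = (n+1) * bM n := by
  have key := intervalIntegral.integral_eq_sub_of_hasDerivAt_of_le (a := -1) (b := 1)
    (f := fun t : ℝ => t^(n+1) * (1 - t^2) ^ (1/4 : ℝ))
    (f' := fun t : ℝ => (n+1) * (t^n * (1 - t^2) ^ (-(3/4) : ℝ)) - (n + 3/2) * (t^(n+2) * (1 - t^2) ^ (-(3/4) : ℝ)))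
    (by norm_num) ?_ ?_ ?_
  · rw [intervalIntegral.integral_of_le (by norm_num), integral_Ioc_eq_integral_Ioo,
      integral_sub ((mom_int n).const_mul _) ((mom_int (n+2)).const_mul _),
      integral_const_mul, integral_const_mul] at key
    norm_num at key
    unfold bM
    norm_num
    linarith
  · apply Continuous.continuousOn
    apply Continuous.mul (by fun_prop)
    exact Continuous.rpow_const (by fun_prop) (fun x => Or.inr (by norm_num))
  · intro t ht
    have a1 : 0 < 1 - t^2 := by nlinarith [ht.2, ht.1]
    have d1 : HasDerivAt (fun t : ℝ => 1 - t^2) (-(2*t)) t := by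
      simpa using (hasDerivAt_pow 2 t).const_sub 1
    have d2 := d1.rpow_const (p := 1/4) (Or.inl a1.ne')
    have := (hasDerivAt_pow (n+1) t).mul d2
    convert! this using 1
    have e : (1 - t^2) ^ (1/4 : ℝ) = (1-t^2) * (1-t^2) ^ (-(3/4) : ℝ) := by
      conv_rhs => rw [← Real.rpow_one_add' a1.le (by norm_num)]
      norm_num
    rw [e, show (1/4 - 1 : ℝ) = -(3/4) by norm_num]
    push_cast
    ring
  · rw [intervalIntegrable_iff_integrableOn_Ioo_of_le (by norm_num)]
    exact ((mom_int n).const_mul _).sub ((mom_int (n+2)).const_mul _)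

lemma bM_one : bM 1 = 0 := by
  have h : bM 1 = - bM 1 := by
    conv_lhs => unfold bM
    rw [← integral_Ioc_eq_integral_Ioo, ← intervalIntegral.integral_of_le (by norm_num)]
    have := intervalIntegral.integral_comp_neg (a := -1) (b := 1) (fun t : ℝ => t ^ 1 * (1 - t^2) ^ (-(3/4) : ℝ))
    norm_num at this
    unfold bM
    rw [← integral_Ioc_eq_integral_Ioo, ← intervalIntegral.integral_of_le (by norm_num)]
    norm_num
    linarith
  linarith

lemma bM_odd (k : ℕ) : bM (2*k+1) = 0 := by
  induction k with
  | zero => exact bM_one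
  | succ k ih =>
    have := bM_rec (2*k+1)
    rw [ih, mul_zero] at this
    rcases mul_eq_zero.1 this with h | h
    · exact h
    · exfalso; have : (0:ℝ) < ((2*k+1 : ℕ):ℝ) + 3/2 := by positivity
      linarith

lemma bM_even (k : ℕ) : poch (1/4) (2*k) / (2*k)! * bM (2*k) =
    poch (1/8) k * poch (5/8) k / (poch (3/4) k * k !) * bM 0 := by
  induction k with
  | zero => simp [poch]
  | succ k ih =>
    have h := bM_rec (2*k)
    have h3 := (poch_pos (3/4) (by norm_num) k).ne'
    have e : bM (2*(k+1)) = ((2*k:ℕ)+1) / ((2*k:ℕ) + 3/2) * bM (2*k) := by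
      rw [div_mul_eq_mul_div, eq_div_iff (by positivity)]; exact h
    have : poch (1/4) (2*(k+1)) / (2*(k+1))! * bM (2*(k+1)) =
      (poch (1/4) (2*k) / (2*k)! * bM (2*k)) * ((1/8+k)*(5/8+k)/((3/4+k)*(k+1))) := by
      rw [e, show 2*(k+1) = 2*k+1+1 by ring, poch_succ, poch_succ, Nat.factorial_succ, Nat.factorial_succ]
      push_cast
      field_simp
      ring
    rw [this, ih, poch_succ, poch_succ, poch_succ, Nat.factorial_succ]
    push_cast
    field_simp

lemma series_int (w : ℝ) (hw0 : 0 ≤ w) (hw : w < 1) :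
    twoFone (1/8) (5/8) (3/4) (w^2) * (∫ t in Ioo (-1:ℝ) 1, (1 - t^2) ^ (-(3/4) : ℝ)) =
    ∫ t in Ioo (-1:ℝ) 1, (1 - w*t) ^ (-(1/4) : ℝ) * (1 - t^2) ^ (-(3/4) : ℝ) := by
  have hb0 : bM 0 = ∫ t in Ioo (-1:ℝ) 1, (1 - t^2) ^ (-(3/4) : ℝ) := by simp [bM]
  have hsw := binom_hasSum w (by rwa [abs_of_nonneg hw0])
  have key := hasSum_integral_of_dominated_convergence (μ := volume.restrict (Ioo (-1:ℝ) 1))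
    (F := fun (n:ℕ) (t:ℝ) => (poch (1/4) n / n ! * w^n) * (t^n * (1 - t^2) ^ (-(3/4) : ℝ)))
    (f := fun t => (1 - w*t) ^ (-(1/4) : ℝ) * (1 - t^2) ^ (-(3/4) : ℝ))
    (fun n t => (poch (1/4) n / n ! * w^n) * (1 - t^2) ^ (-(3/4) : ℝ)) ?_ ?_ ?_ ?_ ?_
  · simp only [integral_const_mul] at key
    rw [← hb0, ← key.tsum_eq]
    unfold twoFone
    rw [← tsum_mul_right]
    have inj : Function.Injective (fun k : ℕ => 2*k) := fun a b h => by simpa using h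
    rw [← inj.tsum_eq (f := fun n : ℕ => poch (1/4) n / n ! * w^n * ∫ a in Ioo (-1:ℝ) 1, a ^ n * (1 - a^2) ^ (-(3/4) : ℝ))]
    · apply tsum_congr
      intro k
      have := bM_even k
      change _ = poch (1/4) (2*k) / (2*k)! * w^(2*k) * bM (2*k)
      calc _ = (poch (1/8) k * poch (5/8) k / (poch (3/4) k * k !) * bM 0) * (w^2)^k := by ring
        _ = _ := by rw [← this, ← pow_mul]; ring
    · intro n hn
      rcases Nat.even_or_odd' n with ⟨k, rfl | rfl⟩
      · exact ⟨k, rfl⟩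
      · exfalso; apply hn
        change _ * bM (2*k+1) = 0
        rw [bM_odd, mul_zero]
  · intro n
    apply Measurable.aestronglyMeasurable
    fun_prop
  · intro n
    rw [ae_restrict_iff' measurableSet_Ioo]
    refine Filter.Eventually.of_forall fun t ht => ?_
    have a1 : 0 < 1 - t^2 := by nlinarith [ht.2, ht.1]
    have p1 : 0 < (1-t^2) ^ (-(3/4) : ℝ) := by positivity
    have p2 := poch_pos (1/4) (by norm_num) n
    have p3 : 0 ≤ poch (1/4) n / n ! * w^n := by positivity
    rw [norm_mul, Real.norm_of_nonneg p3, norm_mul, Real.norm_of_nonneg p1.le, norm_pow, Real.norm_eq_abs]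
    have : |t|^n ≤ 1 := pow_le_one₀ (abs_nonneg t) (abs_le.2 ⟨ht.1.le, ht.2.le⟩)
    gcongr
    nlinarith
  · refine Filter.Eventually.of_forall fun t => ?_
    exact hsw.summable.mul_right _
  · simp only [tsum_mul_right]
    exact base_int.const_mul _
  · rw [ae_restrict_iff' measurableSet_Ioo]
    refine Filter.Eventually.of_forall fun t ht => ?_
    have hlt : |w*t| < 1 := by
      rw [abs_mul, abs_of_nonneg hw0]
      have : |t| ≤ 1 := abs_le.2 ⟨ht.1.le, ht.2.le⟩
      nlinarith
    have := (binom_hasSum (w*t) hlt).mul_right ((1 - t^2) ^ (-(3/4) : ℝ))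
    refine this.congr_fun ?_
    intro n; simp only [mul_pow]; ring

lemma subst_inc (f f' : ℝ → ℝ) (a b : ℝ) (hab : a < b) (hc : ContinuousOn f (Icc a b))
    (hd : ∀ x ∈ Ioo a b, HasDerivAt f (f' x) x) (hp : ∀ x ∈ Ioo a b, 0 < f' x)
    (ha : f a = -1) (hb : f b = 1) (g h : ℝ → ℝ)
    (hgh : ∀ x ∈ Ioo a b, |f' x| * g (f x) = h x) :
    ∫ x in Ioo a b, h x = ∫ x in Ioo (-1) 1, g x := by
  have hm : StrictMonoOn f (Icc a b) := by
    apply strictMonoOn_of_deriv_pos (convex_Icc a b) hc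
    intro x hx
    rw [interior_Icc] at hx
    rw [(hd x hx).deriv]; exact hp x hx
  have him : f '' Ioo a b = Ioo (-1) 1 := by
    apply Subset.antisymm
    · rintro _ ⟨x, hx, rfl⟩
      have hx' := Ioo_subset_Icc_self hx
      exact ⟨ha ▸ hm (left_mem_Icc.2 hab.le) hx' hx.1, hb ▸ hm hx' (right_mem_Icc.2 hab.le) hx.2⟩
    · have := intermediate_value_Ioo hab.le hc
      rwa [ha, hb] at this
  rw [← him, integral_image_eq_integral_abs_deriv_smul measurableSet_Ioo
    (fun x hx => (hd x hx).hasDerivWithinAt) (hm.injOn.mono Ioo_subset_Icc_self)]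
  apply setIntegral_congr_fun measurableSet_Ioo
  intro x hx
  simp only [smul_eq_mul]
  exact (hgh x hx).symm

lemma subst_dec (f f' : ℝ → ℝ) (a b : ℝ) (hab : a < b) (hc : ContinuousOn f (Icc a b))
    (hd : ∀ x ∈ Ioo a b, HasDerivAt f (f' x) x) (hp : ∀ x ∈ Ioo a b, f' x < 0)
    (ha : f a = 1) (hb : f b = -1) (g h : ℝ → ℝ)
    (hgh : ∀ x ∈ Ioo a b, |f' x| * g (f x) = h x) :
    ∫ x in Ioo a b, h x = ∫ x in Ioo (-1) 1, g x := by
  have hm : StrictAntiOn f (Icc a b) := by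
    apply strictAntiOn_of_deriv_neg (convex_Icc a b) hc
    intro x hx
    rw [interior_Icc] at hx
    rw [(hd x hx).deriv]; exact hp x hx
  have him : f '' Ioo a b = Ioo (-1) 1 := by
    apply Subset.antisymm
    · rintro _ ⟨x, hx, rfl⟩
      have hx' := Ioo_subset_Icc_self hx
      exact ⟨hb ▸ hm hx' (right_mem_Icc.2 hab.le) hx.2, ha ▸ hm (left_mem_Icc.2 hab.le) hx' hx.1⟩
    · have := intermediate_value_Ioo' hab.le hc
      rwa [ha, hb] at this
  rw [← him, integral_image_eq_integral_abs_deriv_smul measurableSet_Ioo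
    (fun x hx => (hd x hx).hasDerivWithinAt) (hm.injOn.mono Ioo_subset_Icc_self)]
  apply setIntegral_congr_fun measurableSet_Ioo
  intro x hx
  simp only [smul_eq_mul]
  exact (hgh x hx).symm

noncomputable def qM (Q : ℝ) : ℝ := 1024*Q^2 - 2240*Q + 1215
noncomputable def qG (Q : ℝ) : ℝ :=
  1062882 - 4625505*Q + 8553600*Q^2 - 8529920*Q^3 + 4587520*Q^4 - 1048576*Q^5
noncomputable def qB (Q : ℝ) : ℝ := 4*(1-Q)*(32*Q-27)^4*(81-80*Q)^3

lemma qG_sq (Q : ℝ) : Q^2 * qM Q^4 + qB Q = qG Q^2 := by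
  unfold qM qG qB; ring

lemma qG_pos (Q : ℝ) (h1 : Q ≤ 1) : 0 < qG Q := by
  have h : qG Q = 1 + 865*(1-Q) + 3200*(1-Q)^2+(1-Q)^3*(665600 - 655360*(1-Q) + 1048576*(1-Q)^2) := by
    unfold qG; ring
  rw [h]
  have : 0 ≤ 1 - Q := by linarith
  have : 0 < 665600 - 655360*(1-Q) + 1048576*(1-Q)^2 := by nlinarith [sq_nonneg ((1-Q) - 5/16)]
  positivity

/-- The substitution. -/
noncomputable def qT (v : ℝ) : ℝ := 2 * (v^2)^2 * qM (v^2)^4 / qG (v^2)^2 - 1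
noncomputable def qT' (v : ℝ) : ℝ :=
  -(80 * v * v^2 * qM (v^2)^3 * (32*v^2-27)^3*(81-80*v^2)^2 / qG (v^2)^3)

lemma qT_deriv (v : ℝ) (h : qG (v^2) ≠ 0) : HasDerivAt qT (qT' v) v := by
  have hQ : HasDerivAt (fun v : ℝ => v^2) (2*v) v := by simpa using hasDerivAt_pow 2 v
  have hM : HasDerivAt qM (2048*(v^2) - 2240) (v^2) := by
    unfold qM
    have := ((((hasDerivAt_id (v^2)).pow 2).const_mul 1024).sub ((hasDerivAt_id (v^2)).const_mul 2240)).add_const 1215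
    convert! this using 1
    simp; ring
  have hG : HasDerivAt qG (- 4625505 + 17107200*(v^2) - 25589760*(v^2)^2 + 18350080*(v^2)^3 - 5242880*(v^2)^4) (v^2) := by
    unfold qG
    have := (((((hasDerivAt_id (v^2)).const_mul (-4625505)).add (((hasDerivAt_id (v^2)).pow 2).const_mul 8553600)).add
      (((hasDerivAt_id (v^2)).pow 3).const_mul (-8529920))).add (((hasDerivAt_id (v^2)).pow 4).const_mul 4587520)).add
      (((hasDerivAt_id (v^2)).pow 5).const_mul (-1048576))
    convert! this.const_add 1062882 using 1
    · ext; simp; ring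
    · simp; ring
  have hM' := HasDerivAt.comp (h₂ := qM) (h := fun v : ℝ => v^2) v hM hQ
  have hG' := HasDerivAt.comp (h₂ := qG) (h := fun v : ℝ => v^2) v hG hQ
  have := ((((hQ.pow 2).const_mul 2).mul (hM'.pow 4)).div (hG'.pow 2) (pow_ne_zero 2 h)).sub_const 1
  convert! this using 1
  unfold qT'
  simp only [Function.comp, Pi.pow_apply]
  field_simp
  unfold qM qG
  simp only [Function.comp, Pi.pow_apply, Pi.mul_apply]
  push_cast
  ring

lemma eq_of_pow4 {x y : ℝ} (hx : 0 ≤ x) (hy : 0 ≤ y) (h : x^4 = y^4) : x = y :=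
  (pow_left_inj₀ hx hy (by norm_num)).1 h

lemma rpow34 {r : ℝ} (hr : 0 ≤ r) : (r ^ (-(3/4) : ℝ))^4 = (r^3)⁻¹ := by
  rw [← Real.rpow_natCast, ← Real.rpow_mul hr, ← Real.rpow_natCast, ← Real.rpow_neg hr]
  norm_num

lemma rpow14 {r : ℝ} (hr : 0 ≤ r) : (r ^ (-(1/4) : ℝ))^4 = r⁻¹ := by
  rw [← Real.rpow_natCast, ← Real.rpow_mul hr, ← Real.rpow_neg_one]
  norm_num

noncomputable def hh (v : ℝ) : ℝ := (1 - v^2) ^ (-(3/4) : ℝ) * (1 - 80/81*v^2) ^ (-(1/4) : ℝ)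

lemma qT_one_sub (v : ℝ) (hG : qG (v^2) ≠ 0) :
    1 - qT v^2 = 4 * ((v^2)^2 * qM (v^2)^4) * qB (v^2) / qG (v^2)^4 := by
  have h := qG_sq (v^2)
  have hB : qB (v^2) = qG (v^2)^2 - (v^2)^2 * qM (v^2)^4 := by linarith
  rw [hB]; unfold qT
  field_simp
  ring

lemma qT_point (v : ℝ) (h0 : 0 < v) (h1 : v < 1) (hM : qM (v^2) ≠ 0) (hP : 32*v^2-27 ≠ 0) :
    |qT' v| * (1 - qT v^2) ^ (-(3/4) : ℝ) = 10/3 * hh v := by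
  have hQ : v^2 < 1 := by nlinarith
  have hG := qG_pos (v^2) hQ.le
  have a1 : 0 < 1 - v^2 := by linarith
  have a2 : 0 < 1 - 80/81*v^2 := by linarith
  have a3 : 0 < 81 - 80*v^2 := by linarith
  have hB : 0 < qB (v^2) := by unfold qB; positivity
  have e := qT_one_sub v hG.ne'
  have hT : 0 < 1 - qT v^2 := by rw [e]; positivity
  unfold hh
  apply eq_of_pow4 (by positivity) (by positivity)
  rw [mul_pow, mul_pow, mul_pow, rpow34 hT.le, rpow34 a1.le, rpow14 a2.le, e, (by decide : Even 4).pow_abs]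
  have e2 : 1 - 80/81*v^2 = (81 - 80*v^2)/81 := by ring
  rw [e2]
  unfold qT' qB
  generalize qM (v^2) = m at *
  generalize qG (v^2) = g at *
  generalize hp : 32*v^2-27 = p at *
  generalize hl : 81 - 80*v^2 = l at *
  generalize ho : 1 - v^2 = o at *
  field_simp
  norm_num

lemma hh_int : IntegrableOn hh (Ioo (-1) 1) := by
  refine Integrable.mono' (base_int.const_mul 3) ?_ ?_
  · apply Measurable.aestronglyMeasurable
    unfold hh
    fun_prop
  · rw [ae_restrict_iff' measurableSet_Ioo]
    refine Filter.Eventually.of_forall fun t ht => ?_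
    have a1 : 0 < 1 - t^2 := by nlinarith [ht.2, ht.1]
    have a2 : 1/81 ≤ 1 - 80/81*t^2 := by linarith
    have a3 : 0 < 1 - 80/81*t^2 := by linarith
    have p1 : 0 < (1-t^2) ^ (-(3/4) : ℝ) := by positivity
    have : (1 - 80/81*t^2) ^ (-(1/4) : ℝ) ≤ 3 := by
      refine le_of_pow_le_pow_left₀ (n := 4) (by norm_num) (by norm_num) ?_
      rw [rpow14 a3.le]
      calc (1 - 80/81*t^2)⁻¹ ≤ (1/81)⁻¹ := by gcongr
        _ ≤ _ := by norm_num
    unfold hh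
    rw [Real.norm_of_nonneg (by positivity)]
    nlinarith

lemma hh_ii (a b : ℝ) (ha : -1 ≤ a) (hab : a ≤ b) (hb : b ≤ 1) : IntervalIntegrable hh volume a b := by
  rw [intervalIntegrable_iff_integrableOn_Ioo_of_le hab]
  exact hh_int.mono_set (Ioo_subset_Ioo ha hb)

lemma qT_cont (a b : ℝ) (ha : 0 ≤ a) (hb : b ≤ 1) : ContinuousOn qT (Icc a b) := by
  intro v hv
  have : v^2 ≤ 1 := by nlinarith [hv.1, hv.2]
  exact (qT_deriv v (qG_pos _ this).ne').continuousAt.continuousWithinAt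

lemma qT_neg_one (v : ℝ) (h : v^2 * qM (v^2) = 0) : qT v = -1 := by
  unfold qT
  rcases mul_eq_zero.1 h with h | h <;> rw [h] <;> simp

lemma qT_pos_one (v : ℝ) (hv : v^2 ≤ 1) (h : qB (v^2) = 0) : qT v = 1 := by
  have hG := qG_pos _ hv
  have := qG_sq (v^2)
  rw [h, add_zero] at this
  unfold qT
  rw [mul_assoc, this]
  field_simp
  norm_num

lemma qM_fac (Q : ℝ) : qM Q = 1024 * ((35 - √10)/32 - Q) * ((35 + √10)/32 - Q) := by
  have : √10^2 = (10:ℝ) := Real.sq_sqrt (by norm_num)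
  unfold qM
  linear_combination this

lemma hh_half : ∫ v in Ioo (0:ℝ) 1, hh v = 9/10 * ∫ t in Ioo (-1:ℝ) 1, (1 - t^2) ^ (-(3/4) : ℝ) := by
  set C := ∫ t in Ioo (-1:ℝ) 1, (1 - t^2) ^ (-(3/4) : ℝ) with hC
  have s10 : √10^2 = (10:ℝ) := Real.sq_sqrt (by norm_num)
  have s10l : 3 < √10 := by
    rw [Real.lt_sqrt (by norm_num)]; norm_num
  have s10u : √10 < 4 := by
    rw [Real.sqrt_lt' (by norm_num)]; norm_num
  obtain ⟨e1, he1, he1q⟩ : ∃ e : ℝ, 0 < e ∧ e^2 = 27/32 :=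
    ⟨√(27/32), by positivity, Real.sq_sqrt (by norm_num)⟩
  obtain ⟨e2, he2, he2q⟩ : ∃ e : ℝ, 0 < e ∧ e^2 = (35 - √10)/32 :=
    ⟨√((35 - √10)/32), Real.sqrt_pos.2 (by linarith), Real.sq_sqrt (by linarith)⟩
  have h12 : e1 < e2 := by
    apply lt_of_pow_lt_pow_left₀ 2 he2.le; linarith
  have h21 : e2 < 1 := by
    apply lt_of_pow_lt_pow_left₀ 2 (by norm_num); linarith
  have hsq : ∀ v : ℝ, 0 ≤ v → v ≤ 1 → v^2 ≤ 1 := fun v h h' => by nlinarith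
  have I1 : ∫ v in Ioo 0 e1, 10/3 * hh v = C := by
    have sg : ∀ v ∈ Ioo 0 e1, 32*v^2-27 < 0 ∧ 0 < qM (v^2) := by
      intro v hv
      have : v^2 < e1^2 := pow_lt_pow_left₀ hv.2 hv.1.le (by norm_num)
      refine ⟨by linarith, ?_⟩
      rw [qM_fac]
      apply mul_pos (mul_pos (by norm_num) (by linarith)) (by linarith)
    apply subst_inc qT qT' 0 e1 he1 (qT_cont _ _ le_rfl (by linarith))
      (fun v hv => qT_deriv v (qG_pos _ (hsq v hv.1.le (by linarith [hv.2]))).ne') ?_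
      (qT_neg_one _ (by simp)) (qT_pos_one _ (hsq _ he1.le (by linarith)) (by unfold qB; rw [he1q]; norm_num))
    · intro v hv
      exact qT_point v hv.1 (by linarith [hv.2]) (sg v hv).2.ne' (sg v hv).1.ne
    · intro v hv
      have hG := qG_pos _ (hsq v hv.1.le (by linarith [hv.2]))
      have h3 : (32*v^2-27)^3 < 0 := Odd.pow_neg (by decide) (sg v hv).1
      have hM := (sg v hv).2
      have hv0 := hv.1
      have : 0 < 81 - 80*v^2 := by linarith [hsq v hv.1.le (by linarith [hv.2])]
      unfold qT'
      rw [Left.neg_pos_iff]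
      apply div_neg_of_neg_of_pos _ (by positivity)
      apply mul_neg_of_neg_of_pos _ (by positivity)
      apply mul_neg_of_pos_of_neg (by positivity) h3
  have I2 : ∫ v in Ioo e1 e2, 10/3 * hh v = C := by
    have sg : ∀ v ∈ Ioo e1 e2, 0 < 32*v^2-27 ∧ 0 < qM (v^2) := by
      intro v hv
      have h1 : e1^2 < v^2 := pow_lt_pow_left₀ hv.1 he1.le (by norm_num)
      have h2 : v^2 < e2^2 := pow_lt_pow_left₀ hv.2 (by linarith [hv.1]) (by norm_num)
      refine ⟨by linarith, ?_⟩
      rw [qM_fac]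
      apply mul_pos (mul_pos (by norm_num) (by linarith)) (by linarith)
    apply subst_dec qT qT' e1 e2 h12 (qT_cont _ _ he1.le (by linarith))
      (fun v hv => qT_deriv v (qG_pos _ (hsq v (by linarith [hv.1]) (by linarith [hv.2]))).ne') ?_
      (qT_pos_one _ (hsq _ he1.le (by linarith)) (by unfold qB; rw [he1q]; norm_num))
      (qT_neg_one _ (by rw [qM_fac, he2q]; ring))
    · intro v hv
      exact qT_point v (by linarith [hv.1]) (by linarith [hv.2]) (sg v hv).2.ne' (sg v hv).1.ne'
    · intro v hv
      have hv0 : 0 < v := by linarith [hv.1]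
      have hG := qG_pos _ (hsq v hv0.le (by linarith [hv.2]))
      have h3 := (sg v hv).1
      have hM := (sg v hv).2
      have : 0 < 81 - 80*v^2 := by linarith [hsq v hv0.le (by linarith [hv.2])]
      unfold qT'
      rw [Left.neg_neg_iff]
      positivity
  have I3 : ∫ v in Ioo e2 1, 10/3 * hh v = C := by
    have sg : ∀ v ∈ Ioo e2 1, 0 < 32*v^2-27 ∧ qM (v^2) < 0 := by
      intro v hv
      have h1 : e2^2 < v^2 := pow_lt_pow_left₀ hv.1 he2.le (by norm_num)
      have h2 : v^2 ≤ 1 := hsq v (by linarith [hv.1]) hv.2.le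
      refine ⟨by linarith, ?_⟩
      rw [qM_fac]
      apply mul_neg_of_neg_of_pos (mul_neg_of_pos_of_neg (by norm_num) (by linarith)) (by linarith)
    apply subst_inc qT qT' e2 1 h21 (qT_cont _ _ he2.le le_rfl)
      (fun v hv => qT_deriv v (qG_pos _ (hsq v (by linarith [hv.1]) (by linarith [hv.2]))).ne') ?_
      (qT_neg_one _ (by rw [qM_fac, he2q]; ring))
      (qT_pos_one _ (by norm_num) (by unfold qB; norm_num))
    · intro v hv
      exact qT_point v (by linarith [hv.1]) hv.2 (sg v hv).2.ne (sg v hv).1.ne'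
    · intro v hv
      have hv0 : 0 < v := by linarith [hv.1]
      have hG := qG_pos _ (hsq v hv0.le (by linarith [hv.2]))
      have h3 := (sg v hv).1
      have hM : qM (v^2)^3 < 0 := Odd.pow_neg (by decide) (sg v hv).2
      have : 0 < 81 - 80*v^2 := by linarith [hsq v hv0.le (by linarith [hv.2])]
      unfold qT'
      rw [Left.neg_pos_iff]
      apply div_neg_of_neg_of_pos _ (by positivity)
      apply mul_neg_of_neg_of_pos _ (by positivity)
      apply mul_neg_of_neg_of_pos _ (by positivity)
      apply mul_neg_of_pos_of_neg (by positivity) hM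
  rw [integral_const_mul] at I1 I2 I3
  rw [← integral_Ioc_eq_integral_Ioo, ← intervalIntegral.integral_of_le (by linarith)] at I1 I2 I3 ⊢
  rw [← intervalIntegral.integral_add_adjacent_intervals (b := e1) (hh_ii _ _ (by linarith) (by linarith) (by linarith)) (hh_ii _ _ (by linarith) (by linarith) (by linarith)),
    ← intervalIntegral.integral_add_adjacent_intervals (a := e1) (b := e2) (hh_ii _ _ (by linarith) (by linarith) (by linarith)) (hh_ii _ _ (by linarith) (by linarith) (by linarith))]
  linarith

lemma hh_full : ∫ v in Ioo (-1:ℝ) 1, hh v = 9/5 * ∫ t in Ioo (-1:ℝ) 1, (1 - t^2) ^ (-(3/4) : ℝ) := by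
  have h := hh_half
  rw [← integral_Ioc_eq_integral_Ioo, ← intervalIntegral.integral_of_le (by norm_num)] at h ⊢
  rw [← intervalIntegral.integral_add_adjacent_intervals (b := 0) (hh_ii _ _ (by norm_num) (by norm_num) (by norm_num)) (hh_ii _ _ (by norm_num) (by norm_num) (by norm_num))]
  have e := intervalIntegral.integral_comp_neg (a := 0) (b := 1) hh
  have e' : ∀ v, hh (-v) = hh v := by intro v; simp [hh]
  simp only [e', neg_zero] at e
  rw [← e, h]
  ring

lemma mobius (a w : ℝ) (ha0 : 0 < a) (ha : a^2 = 80/81) (hw : w = 162/161 * a) :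
    ∫ t in Ioo (-1:ℝ) 1, (161/81:ℝ) ^ (-(1/4) : ℝ) * ((1 - w*t) ^ (-(1/4) : ℝ) * (1 - t^2) ^ (-(3/4) : ℝ)) =
    ∫ v in Ioo (-1:ℝ) 1, hh v := by
  have ha1 : a < 1 := by nlinarith
  symm
  have pos : ∀ v : ℝ, -1 ≤ v → v ≤ 1 → 0 < 1 + a*v := fun v h h' => by nlinarith
  have pos' : ∀ v : ℝ, -1 ≤ v → v ≤ 1 → 0 < 1 - a*v := fun v h h' => by nlinarith
  have hd : ∀ v : ℝ, -1 ≤ v → v ≤ 1 →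
      HasDerivAt (fun v : ℝ => (v + a)/(1 + a*v)) ((1-a^2)/(1+a*v)^2) v := by
    intro v h h'
    have h1 : HasDerivAt (fun v : ℝ => v + a) 1 v := (hasDerivAt_id v).add_const a
    have h2 : HasDerivAt (fun v : ℝ => 1 + a*v) a v := by
      simpa using ((hasDerivAt_id v).const_mul a).const_add 1
    convert! h1.div h2 (pos v h h').ne' using 1
    ring
  apply subst_inc (fun v => (v + a)/(1 + a*v)) (fun v => (1-a^2)/(1+a*v)^2) (-1) 1 (by norm_num)
    (fun v hv => (hd v hv.1 hv.2).continuousAt.continuousWithinAt)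
    (fun v hv => hd v hv.1.le hv.2.le) ?_ ?_ ?_
  · intro v hv
    have p := pos v hv.1.le hv.2.le
    have p' := pos' v hv.1.le hv.2.le
    have a1 : 0 < 1 - v^2 := by nlinarith [hv.1, hv.2]
    have a2 : 1 - 80/81*v^2 = (1-a*v)*(1+a*v) := by rw [← ha]; ring
    have b1 : 1 - ((v+a)/(1+a*v))^2 = (1/81)*(1-v^2)/(1+a*v)^2 := by
      have hn := p.ne'
      rw [div_pow, eq_div_iff (pow_ne_zero 2 hn), sub_mul, div_mul_cancel₀ _ (pow_ne_zero 2 hn)]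
      linear_combination (v^2 - 1) * ha
    have b2 : 1 - w*((v+a)/(1+a*v)) = (1/161)*(1-a*v)/(1+a*v) := by
      rw [hw]
      have hn := p.ne'
      rw [eq_div_iff hn, sub_mul, mul_assoc, div_mul_cancel₀ _ hn]
      linear_combination (-162/161) * ha
    have b3 : (1 - a^2 : ℝ) = 1/81 := by rw [ha]; norm_num
    rw [b1, b2, b3, abs_of_pos (by positivity)]
    unfold hh
    rw [a2]
    apply eq_of_pow4 (by positivity) (by positivity)
    simp only [mul_pow]
    rw [rpow34 (by positivity), rpow34 (by positivity), rpow14 (by positivity), rpow14 (by positivity), rpow14 (by positivity)]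
    field_simp
  · intro v hv
    have p := pos v hv.1.le hv.2.le
    have : 0 < 1 - a^2 := by nlinarith
    positivity
  · have := pos' 1 (by norm_num) (by norm_num)
    rw [div_eq_iff (by linarith)]; ring
  · have := pos 1 (by norm_num) (by norm_num)
    rw [div_eq_iff (by linarith)]; ring

theorem stmt5 : twoFone (1/8) (5/8) (3/4) (25920/25921) = (3/5) * (161:ℝ) ^ ((1:ℝ)/4) := by
  obtain ⟨a, ha0, ha⟩ : ∃ a : ℝ, 0 < a ∧ a^2 = 80/81 :=
    ⟨√(80/81), by positivity, Real.sq_sqrt (by norm_num)⟩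
  have hw2 : (162/161*a)^2 = 25920/25921 := by rw [mul_pow, ha]; norm_num
  have hw1 : 162/161*a < 1 := by
    apply lt_of_pow_lt_pow_left₀ 2 (by norm_num); rw [hw2]; norm_num
  have h1 := series_int (162/161*a) (by positivity) hw1
  have h2 := mobius a _ ha0 ha rfl
  rw [integral_const_mul, ← h1, hh_full, hw2, ← mul_assoc] at h2
  have hC : (∫ t in Ioo (-1:ℝ) 1, (1 - t^2) ^ (-(3/4) : ℝ)) ≠ 0 := by
    apply ne_of_gt
    rw [setIntegral_pos_iff_support_of_nonneg_ae _ base_int]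
    · have : Ioo (-1:ℝ) 1 ⊆ Function.support (fun t : ℝ => (1 - t^2) ^ (-(3/4) : ℝ)) ∩ Ioo (-1) 1 := by
        intro t ht
        have a1 : 0 < 1 - t^2 := by nlinarith [ht.2, ht.1]
        exact ⟨(Real.rpow_pos_of_pos a1 _).ne', ht⟩
      refine lt_of_lt_of_le ?_ (measure_mono this)
      simp
    · change ∀ᵐ t ∂_, _
      rw [ae_restrict_iff' measurableSet_Ioo]
      refine Filter.Eventually.of_forall fun t ht => ?_
      have a1 : 0 < 1 - t^2 := by nlinarith [ht.2, ht.1]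
      exact (Real.rpow_pos_of_pos a1 _).le
  have h3 := mul_right_cancel₀ hC h2
  have e : (161:ℝ) ^ ((1:ℝ)/4) = 3 * (161/81:ℝ) ^ ((1/4) : ℝ) := by
    rw [Real.div_rpow (by norm_num) (by norm_num)]
    have : (81:ℝ) ^ ((1:ℝ)/4) = 3 := by
      rw [show (81:ℝ) = 3^(4:ℝ) by norm_num, ← Real.rpow_mul (by norm_num)]; norm_num
    rw [this]; ring
  rw [Real.rpow_neg (by norm_num)] at h3
  have hp : (0:ℝ) < (161/81:ℝ) ^ ((1/4) : ℝ) := by positivity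
  rw [e]
  field_simp at h3
  linarith
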